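/- If T is a strongly connected tournament on n ≥ 5 vertices, then 2 ≤ rc(T) ≤ n − 1. -/

import Mathlib

/-- A digraph is given by its arc relation `A`.  It is a tournament if it has no
loops and every two distinct vertices are joined by exactly one arc. -/
def IsTournament {V : Type*} (A : V → V → Prop) : Prop :=
  (∀ v : V, ¬ A v v) ∧ ∀ u v : V, u ≠ v → Xor' (A u v) (A v u)

/-- A (directed) path in the digraph `A`: a list of pairwise distinct vertices
in which every consecutive pair is an arc. -/
def IsDipath {V : Type*} (A : V → V → Prop) (l : List V) : Prop :=
  l.Chain' A ∧ l.Nodup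

/-- The arcs traversed by a path given as a list of vertices. -/
def pathArcs {V : Type*} (l : List V) : List (V × V) := l.zip l.tail

/-- A rainbow path for the arc-colouring `ρ`: a directed path no two of whose
arcs share the same colour. -/
def IsRainbowPath {V C : Type*} (A : V → V → Prop) (ρ : V → V → C) (l : List V) : Prop :=
  IsDipath A l ∧ ((pathArcs l).map (fun p => ρ p.1 p.2)).Nodup

/-- The digraph `A` is rainbow connected under the arc-colouring `ρ` if for every
ordered pair of vertices `u`, `v` there is a rainbow directed `uv`-path. -/
def RainbowConnected {V C : Type*} (A : V → V → Prop) (ρ : V → V → C) : Prop :=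
  ∀ u v : V, ∃ l : List V,
    l.head? = some u ∧ l.getLast? = some v ∧ IsRainbowPath A ρ l

/-- The rainbow connection number of the digraph `A`: the least number of colours
in an arc-colouring making `A` rainbow connected (`⊤` if there is none). -/
noncomputable def rc {V : Type*} (A : V → V → Prop) : ℕ∞ :=
  sInf {k : ℕ∞ | ∃ c : ℕ, k = (c : ℕ∞) ∧ ∃ ρ : V → V → Fin c, RainbowConnected A ρ}

/-- A digraph is strongly connected if for every ordered pair of vertices
there is a directed path from the first to the second. -/
def IsStronglyConnected {V : Type*} (A : V → V → Prop) : Prop :=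
  ∀ u v : V, ∃ l : List V, l.head? = some u ∧ l.getLast? = some v ∧ IsDipath A l

/-- Rainbow connectivity of the subdigraph of `A` induced on `S`, using `k` colours. -/
def RainbowConnectedOn {V : Type*} (A : V → V → Prop) (S : Finset V) (k : ℕ) : Prop :=
  ∃ ρ : V → V → ℕ, (∀ u v, ρ u v < k) ∧ ∀ u ∈ S, ∀ v ∈ S, ∃ l : List V,
    (∀ x ∈ l, x ∈ S) ∧ l.head? = some u ∧ l.getLast? = some v ∧ IsRainbowPath A ρ l

section

variable {V : Type*} {A : V → V → Prop}

theorem mem_of_mem_pathArcs {l : List V} {p : V × V} (hp : p ∈ pathArcs l) :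
    p.1 ∈ l ∧ p.2 ∈ l :=
  ⟨(List.of_mem_zip hp).1, List.mem_of_mem_tail (List.of_mem_zip hp).2⟩

theorem map_pathArcs_congr {ρ σ : V → V → ℕ} {l : List V}
    (h : ∀ x ∈ l, ∀ y ∈ l, ρ x y = σ x y) :
    (pathArcs l).map (fun p => ρ p.1 p.2) = (pathArcs l).map (fun p => σ p.1 p.2) :=
  List.map_congr_left fun _ hp =>
    h _ (mem_of_mem_pathArcs hp).1 _ (mem_of_mem_pathArcs hp).2

theorem IsRainbowPath.congr {ρ σ : V → V → ℕ} {l : List V} (hl : IsRainbowPath A ρ l)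
    (h : ∀ x ∈ l, ∀ y ∈ l, ρ x y = σ x y) : IsRainbowPath A σ l :=
  ⟨hl.1, map_pathArcs_congr h ▸ hl.2⟩

theorem IsRainbowPath.cons {C : Type*} {ρ : V → V → C} {l : List V} {u v : V}
    (hl : IsRainbowPath A ρ l) (hu : l.head? = some u) (hvu : A v u) (hv : v ∉ l)
    (hρ : ∀ p ∈ pathArcs l, ρ p.1 p.2 ≠ ρ v u) : IsRainbowPath A ρ (v :: l) := by
  obtain ⟨⟨hc, hn⟩, hr⟩ := hl
  cases l with
  | nil => simp at hu
  | cons a l =>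
    obtain rfl : a = u := by simpa using hu
    refine ⟨⟨List.isChain_cons_cons.2 ⟨hvu, hc⟩, List.nodup_cons.2 ⟨hv, hn⟩⟩, ?_⟩
    change (List.map _ ((v, a) :: pathArcs (a :: l))).Nodup
    rw [List.map_cons, List.nodup_cons]
    refine ⟨fun hm => ?_, hr⟩
    obtain ⟨p, hp, he⟩ := List.mem_map.1 hm
    exact hρ p hp he

theorem pathArcs_concat {l : List V} {u : V} (hu : l.getLast? = some u) (v : V) :
    pathArcs (l ++ [v]) = pathArcs l ++ [(u, v)] := by
  induction l with
  | nil => simp at hu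
  | cons a l ih =>
    cases l with
    | nil => simp_all [pathArcs]
    | cons b l =>
      have := ih (by simpa using hu)
      simp_all [pathArcs]

theorem IsRainbowPath.concat {C : Type*} {ρ : V → V → C} {l : List V} {u v : V}
    (hl : IsRainbowPath A ρ l) (hu : l.getLast? = some u) (huv : A u v) (hv : v ∉ l)
    (hρ : ∀ p ∈ pathArcs l, ρ p.1 p.2 ≠ ρ u v) : IsRainbowPath A ρ (l ++ [v]) := by
  obtain ⟨⟨hc, hn⟩, hr⟩ := hl
  refine ⟨⟨?_, ?_⟩, ?_⟩
  · exact List.isChain_append.2 ⟨hc, List.isChain_singleton v, by simp_all⟩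
  · exact List.nodup_append.2 ⟨hn, List.nodup_singleton v, by grind⟩
  · rw [pathArcs_concat hu, List.map_append]
    refine List.nodup_append.2 ⟨hr, List.nodup_singleton _, ?_⟩
    rintro _ hm _ hc' rfl
    obtain ⟨p, hp, he⟩ := List.mem_map.1 hm
    exact hρ p hp (he.trans (by simpa using hc'))

theorem isRainbowPath_singleton {C : Type*} (ρ : V → V → C) (v : V) :
    IsRainbowPath A ρ [v] :=
  ⟨⟨List.isChain_singleton v, List.nodup_singleton v⟩, by simp [pathArcs]⟩

theorem isRainbowPath_pair {C : Type*} (ρ : V → V → C) {u v : V} (h : A u v) (hne : u ≠ v) :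
    IsRainbowPath A ρ [u, v] :=
  ⟨⟨List.isChain_pair.2 h, by simpa using hne⟩, by simp [pathArcs]⟩

theorem isRainbowPath_triple {C : Type*} (ρ : V → V → C) {u v w : V} (huv : A u v)
    (hvw : A v w) (hn : [u, v, w].Nodup) (hρ : ρ u v ≠ ρ v w) :
    IsRainbowPath A ρ [u, v, w] := by
  refine ⟨⟨?_, hn⟩, ?_⟩
  · exact List.isChain_cons_cons.2 ⟨huv, List.isChain_pair.2 hvw⟩
  · simp [pathArcs, hρ]

theorem RainbowConnectedOn.mono {S : Finset V} {k m : ℕ} (h : RainbowConnectedOn A S k)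
    (hkm : k ≤ m) : RainbowConnectedOn A S m := by
  obtain ⟨ρ, hρ, h⟩ := h
  exact ⟨ρ, fun u v => (hρ u v).trans_le hkm, h⟩

open Classical in
theorem RainbowConnectedOn.insert_vertex {S : Finset V} {k : ℕ} (h : RainbowConnectedOn A S k)
    {v s t : V} (hv : v ∉ S) (hs : s ∈ S) (ht : t ∈ S) (hsv : A s v) (hvt : A v t) :
    RainbowConnectedOn A (insert v S) (k + 1) := by
  obtain ⟨ρ, hρ, h⟩ := h
  let σ : V → V → ℕ := fun x y => if x = v ∨ y = v then k else ρ x y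
  have hσ : ∀ x ∈ S, ∀ y ∈ S, ρ x y = σ x y := by
    intro x hx y hy
    have h1 : x ≠ v := fun e => hv (e ▸ hx)
    have h2 : y ≠ v := fun e => hv (e ▸ hy)
    simp [σ, h1, h2]
  have hlt : ∀ l : List V, (∀ x ∈ l, x ∈ S) → ∀ p ∈ pathArcs l, σ p.1 p.2 ≠ k := by
    intro l hl p hp
    have hm := mem_of_mem_pathArcs hp
    rw [← hσ _ (hl _ hm.1) _ (hl _ hm.2)]
    exact (hρ _ _).ne
  refine ⟨σ, fun x y => ?_, fun x hx y hy => ?_⟩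
  · have := hρ x y
    simp only [σ]
    split_ifs <;> omega
  · rcases Finset.mem_insert.1 hx with rfl | hxS
    · rcases Finset.mem_insert.1 hy with rfl | hy
      · exact ⟨[y], by simp, rfl, rfl, isRainbowPath_singleton σ y⟩
      · obtain ⟨l, hl, h1, h2, h3⟩ := h t ht y hy
        refine ⟨x :: l, by simpa using fun a ha => Or.inr (hl a ha), rfl, ?_, ?_⟩
        · rw [List.getLast?_cons, h2]; rfl
        · refine (h3.congr fun a ha b hb => hσ a (hl a ha) b (hl b hb)).cons h1 hvt
            (fun hm => hv (hl _ hm)) fun p hp => ?_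
          simpa [σ] using hlt l hl p hp
    · rcases Finset.mem_insert.1 hy with rfl | hy
      · obtain ⟨l, hl, h1, h2, h3⟩ := h x hxS s hs
        refine ⟨l ++ [y], ?_, ?_, by simp, ?_⟩
        · intro a ha
          rcases List.mem_append.1 ha with ha | ha
          · exact Finset.mem_insert_of_mem (hl a ha)
          · simp_all
        · simp [List.head?_append, h1]
        · refine (h3.congr fun a ha b hb => hσ a (hl a ha) b (hl b hb)).concat h2 hsv
            (fun hm => hv (hl _ hm)) fun p hp => ?_
          simpa [σ] using hlt l hl p hp
      · obtain ⟨l, hl, h1, h2, h3⟩ := h x hxS y hy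
        exact ⟨l, fun a ha => Finset.mem_insert_of_mem (hl a ha), h1, h2,
          h3.congr fun a ha b hb => hσ a (hl a ha) b (hl b hb)⟩

open Classical in
theorem RainbowConnectedOn.insert_dominating_dominated {S : Finset V} {k : ℕ}
    (h : RainbowConnectedOn A S k) (hk : 2 ≤ k) (hS : S.Nonempty) {x y : V} (hx : x ∉ S)
    (hy : y ∉ S) (hxy : x ≠ y) (hyx : A y x) (hxS : ∀ s ∈ S, A x s) (hSy : ∀ s ∈ S, A s y) :
    RainbowConnectedOn A (insert x (insert y S)) (k + 1) := by
  obtain ⟨ρ, hρ, h⟩ := h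
  obtain ⟨s₀, hs₀⟩ := hS
  let σ : V → V → ℕ := fun a b =>
    if a = y then k else if a = x then 0 else if b = y then 1 else ρ a b
  have hσ : ∀ a ∈ S, ∀ b ∈ S, ρ a b = σ a b := by
    intro a ha b hb
    have h1 : a ≠ y := fun e => hy (e ▸ ha)
    have h2 : a ≠ x := fun e => hx (e ▸ ha)
    have h3 : b ≠ y := fun e => hy (e ▸ hb)
    simp [σ, h1, h2, h3]
  have nx : ∀ s ∈ S, s ≠ x := fun s hs e => hx (e ▸ hs)
  have ny : ∀ s ∈ S, s ≠ y := fun s hs e => hy (e ▸ hs)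
  have cy : ∀ s, σ y s = k := fun s => by simp [σ]
  have cx : ∀ s, σ x s = 0 := fun s => by simp [σ, hxy]
  have cs : ∀ s ∈ S, σ s y = 1 := fun s hs => by simp [σ, nx s hs, ny s hs]
  refine ⟨σ, fun a b => ?_, fun u hu v hv => ?_⟩
  · have := hρ a b
    simp only [σ]
    split_ifs <;> omega
  simp only [Finset.mem_insert] at hu hv
  rcases hu with rfl | rfl | hu <;> rcases hv with rfl | rfl | hv
  · exact ⟨[v], by simp, rfl, rfl, isRainbowPath_singleton σ v⟩
  · refine ⟨[u, s₀, v], by simp [hs₀], rfl, rfl,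
      isRainbowPath_triple σ (hxS _ hs₀) (hSy _ hs₀) ?_ ?_⟩
    · simp [hxy, (nx _ hs₀).symm, ny _ hs₀]
    · simp [cx, cs _ hs₀]
  · exact ⟨[u, v], by simp [hv], rfl, rfl, isRainbowPath_pair σ (hxS _ hv) (nx _ hv).symm⟩
  · exact ⟨[u, v], by simp, rfl, rfl, isRainbowPath_pair σ hyx hxy.symm⟩
  · exact ⟨[v], by simp, rfl, rfl, isRainbowPath_singleton σ v⟩
  · refine ⟨[u, x, v], by simp [hv], rfl, rfl, isRainbowPath_triple σ hyx (hxS _ hv) ?_ ?_⟩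
    · simp [hxy.symm, (nx _ hv).symm, (ny _ hv).symm]
    · rw [cy, cx]; omega
  · refine ⟨[u, y, v], by simp [hu], rfl, rfl, isRainbowPath_triple σ (hSy _ hu) hyx ?_ ?_⟩
    · simp [hxy.symm, nx _ hu, ny _ hu]
    · rw [cy, cs _ hu]; omega
  · exact ⟨[u, v], by simp [hu], rfl, rfl, isRainbowPath_pair σ (hSy _ hu) (ny _ hu)⟩
  · obtain ⟨l, hl, h1, h2, h3⟩ := h u hu v hv
    exact ⟨l, fun a ha => by simp [hl a ha], h1, h2,
      h3.congr fun a ha b hb => hσ a (hl a ha) b (hl b hb)⟩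

open Classical in
theorem rainbowConnectedOn_directedTriangle {a b c : V} (hn : [a, b, c].Nodup)
    (hab : A a b) (hbc : A b c) (hca : A c a) : RainbowConnectedOn A {a, b, c} 3 := by
  let ρ : V → V → ℕ := fun u _ => if u = a then 0 else if u = b then 1 else 2
  obtain ⟨⟨nab, nac⟩, nbc⟩ : (a ≠ b ∧ a ≠ c) ∧ b ≠ c := by simpa using hn
  refine ⟨ρ, fun u v => by simp only [ρ]; split_ifs <;> omega, fun u hu v hv => ?_⟩
  have ra : ∀ w, ρ a w = 0 := fun w => by simp [ρ]
  have rb : ∀ w, ρ b w = 1 := fun w => by simp [ρ, nab.symm]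
  have rc : ∀ w, ρ c w = 2 := fun w => by simp [ρ, nac.symm, nbc.symm]
  simp only [Finset.mem_insert, Finset.mem_singleton] at hu hv
  have one (w : V) (hw : w ∈ ({a, b, c} : Finset V)) : ∃ l : List V,
      (∀ x ∈ l, x ∈ ({a, b, c} : Finset V)) ∧ l.head? = some w ∧ l.getLast? = some w ∧
        IsRainbowPath A ρ l :=
    ⟨[w], by simpa using hw, rfl, rfl, isRainbowPath_singleton ρ w⟩
  rcases hu with hu | hu | hu <;> rcases hv with hv | hv | hv <;> rw [hu, hv]
  · exact one a (by simp)
  · exact ⟨[a, b], by simp, rfl, rfl, isRainbowPath_pair ρ hab nab⟩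
  · exact ⟨[a, b, c], by simp, rfl, rfl,
      isRainbowPath_triple ρ hab hbc hn (by simp [ra, rb])⟩
  · exact ⟨[b, c, a], by simp, rfl, rfl, isRainbowPath_triple ρ hbc hca
      (by simp [nbc, nab.symm, nac.symm]) (by simp [rb, rc])⟩
  · exact one b (by simp)
  · exact ⟨[b, c], by simp, rfl, rfl, isRainbowPath_pair ρ hbc nbc⟩
  · exact ⟨[c, a], by simp, rfl, rfl, isRainbowPath_pair ρ hca nac.symm⟩
  · exact ⟨[c, a, b], by simp, rfl, rfl, isRainbowPath_triple ρ hca hab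
      (by simp [nbc.symm, nab, nac.symm]) (by simp [ra, rc])⟩
  · exact one c (by simp)

open Classical in
theorem rainbowConnectedOn_strongFour {a b c d : V} (hn : [a, b, c, d].Nodup)
    (hab : A a b) (hbc : A b c) (hcd : A c d) (hda : A d a) (hac : A a c) (hbd : A b d) :
    RainbowConnectedOn A {a, b, c, d} 3 := by
  let ρ : V → V → ℕ := fun u _ => if u = c then 0 else if u = d then 1 else 2
  obtain ⟨⟨nab, nac, nad⟩, ⟨nbc, nbd⟩, ncd⟩ :
      (a ≠ b ∧ a ≠ c ∧ a ≠ d) ∧ (b ≠ c ∧ b ≠ d) ∧ c ≠ d := by simpa using hn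
  refine ⟨ρ, fun u v => by simp only [ρ]; split_ifs <;> omega, fun u hu v hv => ?_⟩
  have ra : ∀ w, ρ a w = 2 := fun w => by simp [ρ, nac, nad]
  have rb : ∀ w, ρ b w = 2 := fun w => by simp [ρ, nbc, nbd]
  have rc : ∀ w, ρ c w = 0 := fun w => by simp [ρ]
  have rd : ∀ w, ρ d w = 1 := fun w => by simp [ρ, ncd.symm]
  simp only [Finset.mem_insert, Finset.mem_singleton] at hu hv
  have one (w : V) (hw : w ∈ ({a, b, c, d} : Finset V)) : ∃ l : List V,
      (∀ x ∈ l, x ∈ ({a, b, c, d} : Finset V)) ∧ l.head? = some w ∧ l.getLast? = some w ∧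
        IsRainbowPath A ρ l :=
    ⟨[w], by simpa using hw, rfl, rfl, isRainbowPath_singleton ρ w⟩
  rcases hu with hu | hu | hu | hu <;> rcases hv with hv | hv | hv | hv <;> rw [hu, hv]
  · exact one a (by simp)
  · exact ⟨[a, b], by simp, rfl, rfl, isRainbowPath_pair ρ hab nab⟩
  · exact ⟨[a, c], by simp, rfl, rfl, isRainbowPath_pair ρ hac nac⟩
  · exact ⟨[a, c, d], by simp, rfl, rfl, isRainbowPath_triple ρ hac hcd
      (by simp [nac, nad, ncd]) (by simp [ra, rc])⟩
  · exact ⟨[b, d, a], by simp, rfl, rfl, isRainbowPath_triple ρ hbd hda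
      (by simp [nbd, nab.symm, nad.symm]) (by simp [rb, rd])⟩
  · exact one b (by simp)
  · exact ⟨[b, c], by simp, rfl, rfl, isRainbowPath_pair ρ hbc nbc⟩
  · exact ⟨[b, d], by simp, rfl, rfl, isRainbowPath_pair ρ hbd nbd⟩
  · exact ⟨[c, d, a], by simp, rfl, rfl, isRainbowPath_triple ρ hcd hda
      (by simp [ncd, nac.symm, nad.symm]) (by simp [rc, rd])⟩
  · refine ⟨[c, d, a, b], by simp, rfl, rfl, ⟨⟨?_, ?_⟩, ?_⟩⟩
    · exact List.isChain_cons_cons.2 ⟨hcd, List.isChain_cons_cons.2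
        ⟨hda, List.isChain_pair.2 hab⟩⟩
    · simp [ncd, nac.symm, nbc.symm, nad.symm, nbd.symm, nab]
    · simp [pathArcs, ra, rc, rd]
  · exact one c (by simp)
  · exact ⟨[c, d], by simp, rfl, rfl, isRainbowPath_pair ρ hcd ncd⟩
  · exact ⟨[d, a], by simp, rfl, rfl, isRainbowPath_pair ρ hda nad.symm⟩
  · exact ⟨[d, a, b], by simp, rfl, rfl, isRainbowPath_triple ρ hda hab
      (by simp [nab, nad.symm, nbd.symm]) (by simp [ra, rd])⟩
  · exact ⟨[d, a, c], by simp, rfl, rfl, isRainbowPath_triple ρ hda hac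
      (by simp [nac, nad.symm, ncd.symm]) (by simp [ra, rd])⟩
  · exact one d (by simp)

theorem IsTournament.adj_or_adj (hT : IsTournament A) {u v : V} (h : u ≠ v) :
    A u v ∨ A v u :=
  (hT.2 u v h).imp And.left And.left

theorem IsTournament.not_adj_of_adj (hT : IsTournament A) {u v : V} (h : A u v) :
    ¬ A v u := by
  have hne : u ≠ v := fun e => hT.1 v (e ▸ h)
  rcases hT.2 u v hne with h' | h'
  · exact h'.2
  · exact absurd h h'.2

theorem IsTournament.ne_of_adj (hT : IsTournament A) {u v : V} (h : A u v) : u ≠ v :=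
  fun e => hT.1 v (e ▸ h)

open Classical in
theorem rainbowConnectedOn_insert_directedTriangle (hT : IsTournament A) {a b c v : V}
    (hn : [a, b, c, v].Nodup) (hab : A a b) (hbc : A b c) (hca : A c a) (hav : A a v)
    (hvb : A v b) : RainbowConnectedOn A {a, b, c, v} 3 := by
  obtain ⟨⟨nab, nac, nav⟩, ⟨nbc, nbv⟩, ncv⟩ :
      (a ≠ b ∧ a ≠ c ∧ a ≠ v) ∧ (b ≠ c ∧ b ≠ v) ∧ c ≠ v := by simpa using hn
  rcases hT.adj_or_adj ncv with hcv | hvc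
  · convert rainbowConnectedOn_strongFour (a := c) (b := a) (c := v) (d := b)
      (by simp [nac.symm, ncv, nbc.symm, nav, nab, nbv.symm]) hca hav hvb hbc hcv hab using 1
    ext w
    simp only [Finset.mem_insert, Finset.mem_singleton]
    tauto
  · convert rainbowConnectedOn_strongFour (a := a) (b := v) (c := b) (d := c)
      (by simp [nav, nab, nac, nbv.symm, ncv.symm, nbc]) hav hvb hbc hca hab hvc using 1
    ext w
    simp only [Finset.mem_insert, Finset.mem_singleton]
    tauto

theorem List.IsChain.getLast?_mem {R : Set V} (hR : ∀ u ∈ R, ∀ v, A u v → v ∈ R) :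
    ∀ {l : List V} {u v : V}, l.IsChain A → l.head? = some u → l.getLast? = some v →
      u ∈ R → v ∈ R
  | [], _, _, _, h, _, _ => by simp at h
  | [a], u, v, _, h1, h2, hu => by
    simp only [List.head?_cons, List.getLast?_singleton, Option.some.injEq] at h1 h2
    rwa [← h2, h1]
  | a :: b :: l, u, v, hc, h1, h2, hu => by
    obtain rfl : a = u := by simpa using h1
    obtain ⟨hab, hc⟩ := List.isChain_cons_cons.1 hc
    exact List.IsChain.getLast?_mem hR hc rfl (by simpa using h2) (hR _ hu _ hab)

theorem IsStronglyConnected.mem_of_closed (hS : IsStronglyConnected A) {R : Set V}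
    (hne : R.Nonempty) (hR : ∀ u ∈ R, ∀ v, A u v → v ∈ R) (v : V) : v ∈ R := by
  obtain ⟨u, hu⟩ := hne
  obtain ⟨l, h1, h2, hc, -⟩ := hS u v
  exact List.IsChain.getLast?_mem hR hc h1 h2 hu

theorem IsStronglyConnected.exists_extension (hS : IsStronglyConnected A)
    (hT : IsTournament A) {S : Finset V} (hne : S.Nonempty) {w : V} (hw : w ∉ S) :
    (∃ v ∉ S, ∃ s ∈ S, ∃ t ∈ S, A s v ∧ A v t) ∨
      ∃ x ∉ S, ∃ y ∉ S, A y x ∧ (∀ s ∈ S, A x s) ∧ ∀ s ∈ S, A s y := by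
  by_contra! hcon
  obtain ⟨h1, h2⟩ := hcon
  have nS : ∀ v ∉ S, ∀ s ∈ S, s ≠ v := fun v hv s hs e => hv (e ▸ hs)
  have key : ∀ v ∉ S, ∀ s ∈ S, A s v → ∀ t ∈ S, A t v := fun v hv s hs hsv t ht =>
    (hT.adj_or_adj (nS v hv t ht)).resolve_right (h1 v hv s hs t ht hsv)
  have key' : ∀ v ∉ S, ∀ s ∈ S, ¬ A s v → ∀ t ∈ S, A v t := fun v hv s hs hsv t ht =>
    (hT.adj_or_adj (nS v hv t ht)).resolve_left fun h => hsv (key v hv t ht h s hs)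
  have hY : ∀ v, v ∈ S ∨ ∀ s ∈ S, A s v := by
    refine hS.mem_of_closed (R := {v | v ∈ S ∨ ∀ s ∈ S, A s v})
      ⟨_, Or.inl hne.choose_spec⟩ ?_
    intro u hu v huv
    by_cases hv : v ∈ S
    · exact Or.inl hv
    by_cases huS : u ∈ S
    · exact Or.inr (key v hv u huS huv)
    have hu := Or.resolve_left hu huS
    right
    by_contra! hns
    obtain ⟨s, hs, hsv⟩ := hns
    obtain ⟨t, ht, htu⟩ := h2 v hv u huS huv (key' v hv s hs hsv)
    exact htu (hu t ht)
  obtain ⟨s, hs⟩ := hne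
  refine hS.mem_of_closed (R := {v | v ∉ S}) ⟨w, hw⟩ ?_ s hs
  intro u hu v huv hv
  exact hT.not_adj_of_adj huv ((hY u).resolve_left hu v hv)

open Classical in
theorem RainbowConnectedOn.extend_univ [Fintype V] (hT : IsTournament A)
    (hS : IsStronglyConnected A) (S : Finset V) (hcard : 3 ≤ S.card)
    (h : RainbowConnectedOn A S (S.card - 1)) :
    RainbowConnectedOn A Finset.univ (Fintype.card V - 1) := by
  by_cases hu : S = Finset.univ
  · subst hu
    exact h
  obtain ⟨w, hw⟩ : ∃ w, w ∉ S := by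
    by_contra! hall
    exact hu (Finset.eq_univ_iff_forall.2 hall)
  have hne : S.Nonempty := Finset.card_pos.1 (by omega)
  have hlt : S.card < Fintype.card V := Finset.card_lt_univ_of_notMem hw
  rcases hS.exists_extension hT hne hw with
    ⟨v, hv, s, hs, t, ht, hsv, hvt⟩ | ⟨x, hx, y, hy, hyx, hxS, hSy⟩
  · have hc := Finset.card_insert_of_notMem hv
    exact extend_univ hT hS (insert v S) (by omega) ((h.insert_vertex hv hs ht hsv hvt).mono (by omega))
  · have hxy := (hT.ne_of_adj hyx).symm
    have hc : (insert x (insert y S)).card = S.card + 2 := by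
      rw [Finset.card_insert_of_notMem (by simp [hxy, hx]), Finset.card_insert_of_notMem hy]
    exact extend_univ hT hS (insert x (insert y S)) (by omega)
      ((h.insert_dominating_dominated (by omega) hne hx hy hxy hyx hxS hSy).mono (by omega))
termination_by Fintype.card V - S.card

open Classical in
theorem rainbowConnectedOn_univ [Fintype V] (hn : 4 ≤ Fintype.card V)
    (hT : IsTournament A) (hS : IsStronglyConnected A) :
    RainbowConnectedOn A Finset.univ (Fintype.card V - 1) := by
  have : Nontrivial V := Fintype.one_lt_card_iff_nontrivial.1 (by omega)
  obtain ⟨a, w, haw⟩ := exists_pair_ne V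
  rcases hS.exists_extension hT (Finset.singleton_nonempty a) (w := w)
    (by simpa using haw.symm) with ⟨v, -, s, hs, t, ht, hsv, hvt⟩ | ⟨c, -, b, -, hbc, hca, hab⟩
  · simp only [Finset.mem_singleton] at hs ht
    exact absurd (ht ▸ hvt) (hT.not_adj_of_adj (hs ▸ hsv))
  replace hca := hca a (by simp)
  replace hab := hab a (by simp)
  have nab := hT.ne_of_adj hab
  have nbc := hT.ne_of_adj hbc
  have nca := hT.ne_of_adj hca
  have h3 : ({a, b, c} : Finset V).card = 3 := Finset.card_eq_three.2
    ⟨a, b, c, nab, nca.symm, nbc, rfl⟩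
  obtain ⟨w, hw⟩ : ∃ w, w ∉ ({a, b, c} : Finset V) := by
    by_contra! hall
    have := Finset.card_univ (α := V) ▸ congrArg Finset.card (Finset.eq_univ_iff_forall.2 hall)
    omega
  have htri := rainbowConnectedOn_directedTriangle (by simp [nab, nca.symm, nbc]) hab hbc hca
  rcases hS.exists_extension hT (Finset.insert_nonempty a _) hw with
    ⟨v, hv, s, hs, t, ht, hsv, hvt⟩ | ⟨x, hx, y, hy, hyx, hxS, hSy⟩
  · have h4 := Finset.card_insert_of_notMem hv
    refine RainbowConnectedOn.extend_univ hT hS (insert v {a, b, c}) (by omega) ?_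
    rw [h4, h3]
    obtain ⟨nva, nvb, nvc⟩ : v ≠ a ∧ v ≠ b ∧ v ≠ c := by simpa using hv
    have hcases : (A a v ∧ A v b) ∨ (A b v ∧ A v c) ∨ (A c v ∧ A v a) := by
      have ha := hT.adj_or_adj nva
      have hb := hT.adj_or_adj nvb
      have hc := hT.adj_or_adj nvc
      have hns := hT.not_adj_of_adj hsv
      have hnt := hT.not_adj_of_adj hvt
      simp only [Finset.mem_insert, Finset.mem_singleton] at hs ht
      rcases hs with rfl | rfl | rfl <;> rcases ht with rfl | rfl | rfl <;> tauto
    rcases hcases with ⟨h1, h2⟩ | ⟨h1, h2⟩ | ⟨h1, h2⟩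
    · convert rainbowConnectedOn_insert_directedTriangle hT
        (by simp [nab, nca.symm, nva.symm, nbc, nvb.symm, nvc.symm]) hab hbc hca h1 h2 using 1
      ext z
      simp only [Finset.mem_insert, Finset.mem_singleton]
      tauto
    · convert rainbowConnectedOn_insert_directedTriangle hT
        (by simp [nab.symm, nca, nva.symm, nbc, nvb.symm, nvc.symm]) hbc hca hab h1 h2 using 1
      ext z
      simp only [Finset.mem_insert, Finset.mem_singleton]
      tauto
    · convert rainbowConnectedOn_insert_directedTriangle hT
        (by simp [nab, nca, nva.symm, nbc.symm, nvb.symm, nvc.symm]) hca hab hbc h1 h2 using 1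
      ext z
      simp only [Finset.mem_insert, Finset.mem_singleton]
      tauto
  · have hxy := (hT.ne_of_adj hyx).symm
    have h5 : (insert x (insert y ({a, b, c} : Finset V))).card = 5 := by
      rw [Finset.card_insert_of_notMem (Finset.mem_insert.not.2 (not_or.2 ⟨hxy, hx⟩)),
        Finset.card_insert_of_notMem hy, h3]
    refine RainbowConnectedOn.extend_univ hT hS (insert x (insert y {a, b, c})) (by omega) ?_
    rw [h5]
    exact htri.insert_dominating_dominated (by omega) (Finset.insert_nonempty a _) hx hy hxy hyx hxS hSy

theorem RainbowConnectedOn.rc_le [Fintype V] {k : ℕ}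
    (h : RainbowConnectedOn A Finset.univ k) : rc A ≤ k := by
  obtain ⟨ρ, hρ, h⟩ := h
  refine sInf_le ⟨k, rfl, fun u v => ⟨ρ u v, hρ u v⟩, fun u v => ?_⟩
  obtain ⟨l, -, h1, h2, h3, h4⟩ := h u (Finset.mem_univ u) v (Finset.mem_univ v)
  refine ⟨l, h1, h2, h3, List.Nodup.of_map Fin.val ?_⟩
  rw [List.map_map]
  exact h4

theorem RainbowConnected.adj_of_subsingleton {C : Type*} [Subsingleton C] {ρ : V → V → C}
    (h : RainbowConnected A ρ) {u v : V} (huv : u ≠ v) : A u v := by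
  obtain ⟨l, h1, h2, ⟨hc, -⟩, hr⟩ := h u v
  match l with
  | [] => simp at h1
  | [a] => simp_all
  | [a, b] =>
    have hab : A a b := List.isChain_pair.1 hc
    simp_all
  | a :: b :: c :: l =>
    exact absurd (Subsingleton.elim (ρ a b) (ρ b c)) (by simp_all [pathArcs])

theorem two_le_rc [Nontrivial V] (hT : IsTournament A) : 2 ≤ rc A := by
  refine le_sInf ?_
  rintro k ⟨c, rfl, ρ, hρ⟩
  by_contra hlt
  have hc : c ≤ 1 := by
    have : (c : ℕ∞) < (2 : ℕ) := not_le.1 hlt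
    have := Nat.cast_lt.1 this
    omega
  have : Subsingleton (Fin c) := Fin.subsingleton_iff_le_one.2 hc
  obtain ⟨u, v, huv⟩ := exists_pair_ne V
  exact hT.not_adj_of_adj (hρ.adj_of_subsingleton huv) (hρ.adj_of_subsingleton huv.symm)

end

theorem rc_bounds_of_strong_tournament (V : Type) [Fintype V]
    (hn : 5 ≤ Fintype.card V) (A : V → V → Prop)
    (hT : IsTournament A) (hS : IsStronglyConnected A) :
    2 ≤ rc A ∧ rc A ≤ ((Fintype.card V - 1 : ℕ) : ℕ∞) := by
  have : Nontrivial V := Fintype.one_lt_card_iff_nontrivial.1 (by omega)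
  exact ⟨two_le_rc hT, (rainbowConnectedOn_univ (by omega) hT hS).rc_le⟩
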